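/- arXiv:2310.14622 — 5 statements merged into one kernel-verified Lean document; each statement's English description precedes it below -/
import Mathlib

section
/- Let d ≥ 1, let g > 0, k > 0 and η be real numbers, let h > 0 be a real number, and let G, q ∈ EuclideanSpace ℝ (Fin d). Then the momentum balance g·h·G = −(g·k²·‖q‖/h^η) • q holds if and only if q = −√(h^(η+1)/k²)·(‖G‖)^(−1/2) • G, where the right-hand side is interpreted as the zero vector when G = 0. -/
/-- Inversion of the quadratic friction law `c² G = -‖q‖ q`. -/
theorem sq_smul_eq_neg_norm_smul_self_iff {E : Type*} [NormedAddCommGroup E] [NormedSpace ℝ E]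
    {c : ℝ} (hc : 0 < c) (G q : E) :
    c ^ 2 • G = -(‖q‖ • q) ↔ q = -((c * ‖G‖ ^ (-(1 : ℝ) / 2)) • G) := by
  rcases eq_or_ne G 0 with rfl | hG
  · simp [eq_comm (a := (0 : E))]
  obtain ⟨s, hs, hsG⟩ : ∃ s : ℝ, 0 < s ∧ s ^ 2 = ‖G‖ :=
    ⟨√‖G‖, Real.sqrt_pos.2 (norm_pos_iff.2 hG), Real.sq_sqrt (norm_nonneg G)⟩
  have hpow : ‖G‖ ^ (-(1 : ℝ) / 2) = s⁻¹ := by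
    rw [← hsG, neg_div, Real.rpow_neg (sq_nonneg s), ← Real.sqrt_eq_rpow, Real.sqrt_sq hs.le]
  rw [hpow]
  constructor
  · intro hq
    have hnorm : ‖q‖ = c * s := by
      have hsq := congrArg norm hq
      rw [norm_neg, norm_smul, norm_smul, norm_norm, Real.norm_of_nonneg (sq_nonneg c),
        ← hsG] at hsq
      rw [← pow_left_inj₀ (norm_nonneg q) (by positivity) two_ne_zero]
      linarith
    rw [hnorm] at hq
    have hcs : c * s ≠ 0 := by positivity
    apply smul_right_injective E hcs
    change (c * s) • q = (c * s) • _
    rw [smul_neg, smul_smul, show c * s * (c * s⁻¹) = c ^ 2 by field_simp, hq, neg_neg]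
  · intro hq
    have hnorm : ‖q‖ = c * s := by
      rw [hq, norm_neg, norm_smul, Real.norm_of_nonneg (by positivity), ← hsG]
      field_simp
    rw [hnorm, hq, smul_neg, neg_neg, smul_smul]
    congr 1
    field_simp


/-- The leading-order momentum balance `g h G = −(g k² ‖q‖ / h^η) • q` holds if and only if
`q = −√(h^(η+1)/k²) ‖G‖^(−1/2) • G` (with the convention that the right-hand side is the zero
vector when `G = 0`, which is automatic from `0 ^ (−1/2) = 0` for the real power). -/
theorem momentum_balance_iff_darcy_closure (d : ℕ) (hd : 1 ≤ d)
    (g k η h : ℝ) (hg : 0 < g) (hk : 0 < k) (hh : 0 < h)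
    (G q : EuclideanSpace ℝ (Fin d)) :
    (g * h) • G = -((g * k ^ 2 * ‖q‖ / h ^ η) • q)
      ↔ q = -((Real.sqrt (h ^ (η + 1) / k ^ 2) * ‖G‖ ^ (-(1 : ℝ) / 2)) • G) := by
  have hη : 0 < h ^ η := Real.rpow_pos_of_pos hh η
  have hη₁ : 0 < h ^ (η + 1) / k ^ 2 := by positivity
  rw [← sq_smul_eq_neg_norm_smul_self_iff (Real.sqrt_pos.2 hη₁), Real.sq_sqrt hη₁.le,
    Real.rpow_add_one hh.ne']
  have hfac : g * k ^ 2 / h ^ η ≠ 0 := by positivity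
  rw [← (smul_right_injective (EuclideanSpace ℝ (Fin d)) hfac).eq_iff (a := (h ^ η * h / k ^ 2) • G)]
  simp only [smul_neg, smul_smul]
  rw [show g * k ^ 2 / h ^ η * (h ^ η * h / k ^ 2) = g * h by field_simp,
    show g * k ^ 2 / h ^ η * ‖q‖ = g * k ^ 2 * ‖q‖ / h ^ η by ring]
end

section
/- Let d ≥ 1, let g > 0, k > 0 and η be real numbers, let b : EuclideanSpace ℝ (Fin d) → ℝ be differentiable, and let h₀ : ℝ → EuclideanSpace ℝ (Fin d) → ℝ and q₀ : ℝ → EuclideanSpace ℝ (Fin d) → EuclideanSpace ℝ (Fin d) be such that for every (t, x): h₀(t)(x) > 0, h₀ is differentiable in t, h₀(t) and q₀(t) are differentiable in x, and the leading-order system holds: ∂ₜh₀(t)(x) + div q₀(t)(x) = 0 and ∇((g/2)·h₀(t)²)(x) + g·h₀(t)(x)·∇b(x) = −(g·k²·‖q₀(t)(x)‖/h₀(t)(x)^η) • q₀(t)(x). Then for every (t, x), q₀(t)(x) = −Φ(h₀(t))(x) and ∂ₜh₀(t)(x) = div Φ(h₀(t))(x); that is, h₀ solves the limiting nonlinear diffusion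 (p-Laplacian, p = 3/2 when η = 7/3) equation ∂ₜh₀ = ∇·(√(h₀^(η+1)/k²)·∇H₀/√(‖∇H₀‖)). -/
open scoped BigOperators

/-- Divergence of a vector field on `EuclideanSpace ℝ (Fin d)`:
`div F (x) = ∑ i, ∂ᵢ Fᵢ (x)`. -/
noncomputable def ediv {d : ℕ} (F : EuclideanSpace ℝ (Fin d) → EuclideanSpace ℝ (Fin d))
    (x : EuclideanSpace ℝ (Fin d)) : ℝ :=
  ∑ i, fderiv ℝ F x (EuclideanSpace.single i 1) i

/-- The limiting (Darcy-type) flux `Φ(h)(x) = √(h^(η+1)/k²) ‖∇H‖^(−1/2) • ∇H`, `H = h + b`,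
with the convention `Φ(h)(x) = 0` when `∇H(x) = 0` (automatic since `0 ^ (−1/2) = 0`
for the real power). -/
noncomputable def limFlux {d : ℕ} (k η : ℝ)
    (b h : EuclideanSpace ℝ (Fin d) → ℝ) (x : EuclideanSpace ℝ (Fin d)) :
    EuclideanSpace ℝ (Fin d) :=
  (Real.sqrt ((h x) ^ (η + 1) / k ^ 2)
      * ‖gradient (fun y => h y + b y) x‖ ^ (-(1 : ℝ) / 2)) •
    gradient (fun y => h y + b y) x

/-- Inversion of the quadratic friction law `c G = -‖q‖ q`. -/
lemma eq_neg_smul_of_smul_eq_neg_norm_smul {F : Type*} [NormedAddCommGroup F] [NormedSpace ℝ F]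
    {c : ℝ} (hc : 0 < c) {G q : F} (h : c • G = -(‖q‖ • q)) :
    q = -((Real.sqrt c * ‖G‖ ^ (-(1 : ℝ) / 2)) • G) := by
  rcases eq_or_ne q 0 with rfl | hq
  · have hG : G = 0 := by simpa [hc.ne'] using h
    simp [hG]
  have hq' : 0 < ‖q‖ := norm_pos_iff.mpr hq
  have hnorm : c * ‖G‖ = ‖q‖ ^ 2 := by
    simpa [norm_smul, abs_of_pos hc, sq] using congrArg norm h
  have hG : 0 < ‖G‖ := by
    refine pos_of_mul_pos_right ?_ hc.le
    rw [hnorm]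
    positivity
  have hsqrt : ‖q‖ = Real.sqrt c * Real.sqrt ‖G‖ := by
    rw [← Real.sqrt_mul hc.le, hnorm, Real.sqrt_sq hq'.le]
  have hcoef : ‖q‖ * (Real.sqrt c * ‖G‖ ^ (-(1 : ℝ) / 2)) = c := by
    have hs : Real.sqrt ‖G‖ ≠ 0 := (Real.sqrt_pos.mpr hG).ne'
    rw [neg_div, Real.rpow_neg hG.le, ← Real.sqrt_eq_rpow, hsqrt]
    field_simp
    exact Real.sq_sqrt hc.le
  apply smul_right_injective F hq'.ne'
  change ‖q‖ • q = ‖q‖ • -((Real.sqrt c * ‖G‖ ^ (-(1 : ℝ) / 2)) • G)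
  rw [smul_neg, smul_smul, hcoef, h, neg_neg]

/-- The pressure and bottom terms combine into the gradient of the free surface. -/
lemma gradient_half_mul_sq_add_smul_gradient {F : Type*} [NormedAddCommGroup F]
    [InnerProductSpace ℝ F] [CompleteSpace F] (g : ℝ) {h b : F → ℝ} {x : F}
    (hh : DifferentiableAt ℝ h x) (hb : DifferentiableAt ℝ b x) :
    gradient (fun y => (g / 2) * (h y) ^ 2) x + (g * h x) • gradient b x
      = (g * h x) • gradient (fun y => h y + b y) x := by
  have hsq : fderiv ℝ (fun y => (g / 2) * (h y) ^ 2) x = (g * h x) • fderiv ℝ h x := by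
    rw [((hh.hasFDerivAt.pow 2).const_mul (g / 2)).fderiv, smul_smul]
    congr 1
    norm_num
    ring
  simp only [gradient, hsq, fderiv_fun_add hh hb, map_add, map_smul, smul_add]

lemma ediv_neg {d : ℕ} (F : EuclideanSpace ℝ (Fin d) → EuclideanSpace ℝ (Fin d))
    (x : EuclideanSpace ℝ (Fin d)) : ediv (-F) x = -ediv F x := by
  simp [ediv, fderiv_neg]

/-- Derivation of the diffusive limit: if `(h₀, q₀)` satisfies the leading-order
Chapman–Enskog system `∂ₜh₀ + ∇·q₀ = 0`, `∇((g/2)h₀²) + g h₀ ∇b = −γ₀ q₀`, then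
`q₀ = −Φ(h₀)` and `h₀` solves the limiting nonlinear diffusion (p-Laplacian) equation
`∂ₜh₀ = ∇·Φ(h₀)`. -/
theorem diffusive_limit_equation (d : ℕ) (hd : 1 ≤ d)
    (g k η : ℝ) (hg : 0 < g) (hk : 0 < k)
    (b : EuclideanSpace ℝ (Fin d) → ℝ) (hb : Differentiable ℝ b)
    (h₀ : ℝ → EuclideanSpace ℝ (Fin d) → ℝ)
    (q₀ : ℝ → EuclideanSpace ℝ (Fin d) → EuclideanSpace ℝ (Fin d))
    (hpos : ∀ t x, 0 < h₀ t x)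
    (hdt : ∀ t x, DifferentiableAt ℝ (fun s => h₀ s x) t)
    (hdx : ∀ t x, DifferentiableAt ℝ (h₀ t) x)
    (qdx : ∀ t x, DifferentiableAt ℝ (q₀ t) x)
    (mass : ∀ t x, deriv (fun s => h₀ s x) t + ediv (q₀ t) x = 0)
    (momentum : ∀ t x,
      gradient (fun y => (g / 2) * (h₀ t y) ^ 2) x + (g * h₀ t x) • gradient b x
        = -((g * k ^ 2 * ‖q₀ t x‖ / (h₀ t x) ^ η) • q₀ t x)) :
    (∀ t x, q₀ t x = -limFlux k η b (h₀ t) x) ∧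
    (∀ t x, deriv (fun s => h₀ s x) t = ediv (limFlux k η b (h₀ t)) x) := by
  have hflux : ∀ t x, q₀ t x = -limFlux k η b (h₀ t) x := by
    intro t x
    have hh := hpos t x
    have hη : 0 < h₀ t x ^ η := Real.rpow_pos_of_pos hh η
    apply eq_neg_smul_of_smul_eq_neg_norm_smul (by positivity)
    have hm := momentum t x
    rw [gradient_half_mul_sq_add_smul_gradient g (hdx t x) (hb x)] at hm
    have hcoef : h₀ t x ^ (η + 1) / k ^ 2
        = h₀ t x ^ η / (g * k ^ 2) * (g * h₀ t x) := by
      rw [Real.rpow_add_one hh.ne']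
      field_simp
    rw [hcoef, mul_smul, hm, smul_neg, smul_smul]
    congr 2
    field_simp
  refine ⟨hflux, fun t x => ?_⟩
  have hq : q₀ t = -limFlux k η b (h₀ t) := funext (hflux t)
  have hm := mass t x
  rw [hq, ediv_neg] at hm
  linarith
end

section
/- Let d ≥ 1, let a > 0 be a real number, and let q★ ∈ EuclideanSpace ℝ (Fin d). Then there exists a unique q ∈ EuclideanSpace ℝ (Fin d) satisfying (1 + a·‖q‖) • q = q★, and it is given explicitly by q = (2/(1 + √(1 + 4·a·‖q★‖))) • q★. -/
/-- In a real normed space, for `a ≥ 0`, the equation `(1 + a ‖x‖) • x = y` is solved exactly by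
`x = (2 / (1 + √(1 + 4 a ‖y‖))) • y`. -/
theorem one_add_mul_norm_smul_eq_iff {E : Type*} [NormedAddCommGroup E] [NormedSpace ℝ E]
    {a : ℝ} (ha : 0 ≤ a) (x y : E) :
    (1 + a * ‖x‖) • x = y ↔ x = (2 / (1 + Real.sqrt (1 + 4 * a * ‖y‖))) • y := by
  constructor
  · rintro rfl
    have hpos : 0 < 1 + a * ‖x‖ := by positivity
    have hsqrt : Real.sqrt (1 + 4 * a * ‖(1 + a * ‖x‖) • x‖) = 1 + 2 * (a * ‖x‖) := by
      rw [norm_smul, Real.norm_of_nonneg hpos.le,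
        show 1 + 4 * a * ((1 + a * ‖x‖) * ‖x‖) = (1 + 2 * (a * ‖x‖)) ^ 2 by ring]
      exact Real.sqrt_sq (by positivity)
    have hcoeff : 2 / (1 + (1 + 2 * (a * ‖x‖))) * (1 + a * ‖x‖) = 1 := by
      rw [show 1 + (1 + 2 * (a * ‖x‖)) = 2 * (1 + a * ‖x‖) by ring]
      field_simp
    rw [hsqrt, smul_smul, hcoeff, one_smul]
  · rintro rfl
    have hsq : Real.sqrt (1 + 4 * a * ‖y‖) ^ 2 = 1 + 4 * a * ‖y‖ :=
      Real.sq_sqrt (by positivity)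
    have hs := Real.sqrt_nonneg (1 + 4 * a * ‖y‖)
    generalize Real.sqrt (1 + 4 * a * ‖y‖) = s at hsq hs ⊢
    have hcoeff : (1 + a * (2 / (1 + s) * ‖y‖)) * (2 / (1 + s)) = 1 := by
      have hpos : 0 < 1 + s := by positivity
      field_simp
      linarith
    rw [norm_smul, Real.norm_of_nonneg (by positivity), smul_smul, hcoeff, one_smul]

/-- Exact solvability of the implicit Manning-friction update: for `a > 0`, the equation
`(1 + a ‖q‖) • q = q★` has the unique solution
`q = (2/(1 + √(1 + 4 a ‖q★‖))) • q★`. -/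
theorem implicit_friction_update_unique (d : ℕ) (hd : 1 ≤ d)
    (a : ℝ) (ha : 0 < a) (qs : EuclideanSpace ℝ (Fin d)) :
    ∀ q : EuclideanSpace ℝ (Fin d),
      (1 + a * ‖q‖) • q = qs
        ↔ q = (2 / (1 + Real.sqrt (1 + 4 * a * ‖qs‖))) • qs := by
  exact fun q => one_add_mul_norm_smul_eq_iff ha.le q qs
end

section
/- Let d ≥ 1, let g > 0, k > 0, η ∈ ℝ, Δt > 0, and let b : EuclideanSpace ℝ (Fin d) → ℝ be differentiable. Let hⁿ, hⁿ⁺¹ : EuclideanSpace ℝ (Fin d) → ℝ be positive and differentiable, and let qⁿ, qⁿ⁺¹ be vector fields such that qⁿ, Φ(hⁿ) and Φ(hⁿ⁺¹) are differentiable (so their divergences exist). Assume that for every x: (i) (hⁿ⁺¹(x) − hⁿ(x))/Δt + div qⁿ(x) + div Φ(hⁿ)(x) = div Φ(hⁿ⁺¹)(x); (ii) ∇((g/2)·(hⁿ⁺¹)²)(x) = −g·hⁿ⁺¹(x)·∇b(x) − (g·k²·‖qⁿ⁺¹(x)‖/hⁿ⁺¹(x)^η) • qⁿ⁺¹(x);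 and (iii) the well-preparedness relation qⁿ(x) = −Φ(hⁿ)(x). Then for every x: qⁿ⁺¹(x) = −Φ(hⁿ⁺¹)(x), and (hⁿ⁺¹(x) − hⁿ(x))/Δt = div Φ(hⁿ⁺¹)(x); i.e., in the limit ε → 0 the first-order IMEX scheme becomes a consistent implicit time discretization of the limiting diffusion equation ∂ₜh = ∇·Φ(h) and propagates well-preparedness to the next time level (asymptotic-preserving property, Theorem 3.1 of the paper). -/
open scoped BigOperators

section Gradient

variable {E : Type*} [NormedAddCommGroup E] [InnerProductSpace ℝ E] [CompleteSpace E]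

lemma gradient_add_of_differentiableAt {f b : E → ℝ} {x : E} (hf : DifferentiableAt ℝ f x)
    (hb : DifferentiableAt ℝ b x) :
    gradient (fun y => f y + b y) x = gradient f x + gradient b x := by
  simp only [gradient, fderiv_fun_add hf hb, map_add]

lemma gradient_half_mul_sq {f : E → ℝ} {x : E} (g : ℝ) (hf : DifferentiableAt ℝ f x) :
    gradient (fun y => g / 2 * f y ^ 2) x = (g * f x) • gradient f x := by
  have h : fderiv ℝ (fun y => g / 2 * f y ^ 2) x = (g * f x) • fderiv ℝ f x := by
    rw [((hf.hasFDerivAt.pow 2).const_mul (g / 2)).fderiv, smul_smul]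
    congr 1
    simp
    ring
  simp only [gradient, h, map_smulₛₗ, conj_trivial]

end Gradient

/-- The quadratic friction law `‖q‖ q = -A v` with `A ≥ 0` determines `q`. -/
lemma eq_neg_of_norm_smul_self_eq {E : Type*} [NormedAddCommGroup E] [NormedSpace ℝ E]
    {q v : E} {A : ℝ} (hA : 0 ≤ A)
    (h : ‖q‖ • q = -(A • v)) :
    q = -((√A * ‖v‖ ^ (-(1 : ℝ) / 2)) • v) := by
  have hnorm : ‖q‖ * ‖q‖ = A * ‖v‖ := by
    simpa [norm_smul, abs_of_nonneg hA] using congrArg norm h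
  have hq : ‖q‖ = √A * √‖v‖ := by
    rw [← Real.sqrt_mul hA, ← hnorm, Real.sqrt_mul_self (norm_nonneg q)]
  rcases eq_or_ne q 0 with rfl | hq0
  · have hAv : A • v = 0 := by simpa using h.symm
    rcases smul_eq_zero.mp hAv with h0 | h0 <;> simp [h0]
  · have hqpos : 0 < ‖q‖ := norm_pos_iff.mpr hq0
    have hvpos : 0 < √‖v‖ := by
      refine (Real.sqrt_nonneg _).lt_of_ne fun h0 => ?_
      rw [← h0, mul_zero] at hq
      exact hqpos.ne' hq
    have hpow : ‖v‖ ^ (-(1 : ℝ) / 2) = (√‖v‖)⁻¹ := by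
      rw [Real.sqrt_eq_rpow, ← Real.rpow_neg (norm_nonneg v), neg_div]
    apply smul_right_injective E hqpos.ne'
    change ‖q‖ • q = ‖q‖ • _
    rw [h, smul_neg, smul_smul, hpow, hq]
    congr 2
    field_simp
    exact (Real.sq_sqrt hA).symm

/-- Asymptotic-preserving property of the first-order IMEX scheme (Theorem 3.1): in the
formal limit `ε → 0` and starting from well-prepared data `qⁿ = −Φ(hⁿ)`, the scheme becomes
the implicit Euler discretization `(hⁿ⁺¹ − hⁿ)/Δt = ∇·Φ(hⁿ⁺¹)` of the limiting diffusion
equation, and well-preparedness `qⁿ⁺¹ = −Φ(hⁿ⁺¹)` propagates to the next time level. -/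
theorem first_order_imex_is_AP (d : ℕ) (hd : 1 ≤ d)
    (g k η Δt : ℝ) (hg : 0 < g) (hk : 0 < k) (hΔt : 0 < Δt)
    (b : EuclideanSpace ℝ (Fin d) → ℝ) (hb : Differentiable ℝ b)
    (hn hn1 : EuclideanSpace ℝ (Fin d) → ℝ)
    (hn_pos : ∀ x, 0 < hn x) (hn1_pos : ∀ x, 0 < hn1 x)
    (hn_diff : Differentiable ℝ hn) (hn1_diff : Differentiable ℝ hn1)
    (qn qn1 : EuclideanSpace ℝ (Fin d) → EuclideanSpace ℝ (Fin d))
    (qn_diff : Differentiable ℝ qn)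
    (Φn_diff : Differentiable ℝ (limFlux k η b hn))
    (Φn1_diff : Differentiable ℝ (limFlux k η b hn1))
    (scheme_mass : ∀ x,
      (hn1 x - hn x) / Δt + ediv qn x + ediv (limFlux k η b hn) x
        = ediv (limFlux k η b hn1) x)
    (scheme_momentum : ∀ x,
      gradient (fun y => (g / 2) * (hn1 y) ^ 2) x
        = -((g * hn1 x) • gradient b x)
          - (g * k ^ 2 * ‖qn1 x‖ / (hn1 x) ^ η) • qn1 x)
    (well_prepared : ∀ x, qn x = -limFlux k η b hn x) :
    (∀ x, qn1 x = -limFlux k η b hn1 x) ∧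
    (∀ x, (hn1 x - hn x) / Δt = ediv (limFlux k η b hn1) x) := by
  have hmom : ∀ x, qn1 x = -limFlux k η b hn1 x := by
    intro x
    have hx := hn1_pos x
    have hpow : 0 < hn1 x ^ η := Real.rpow_pos_of_pos hx η
    refine eq_neg_of_norm_smul_self_eq (by positivity) ?_
    have hs := scheme_momentum x
    rw [gradient_half_mul_sq g (hn1_diff x)] at hs
    rw [gradient_add_of_differentiableAt (hn1_diff x) (hb x), Real.rpow_add_one hx.ne']
    have hc : g * k ^ 2 / hn1 x ^ η ≠ 0 := by positivity
    apply smul_right_injective _ hc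
    have hl : (g * k ^ 2 / hn1 x ^ η) * ‖qn1 x‖ = g * k ^ 2 * ‖qn1 x‖ / hn1 x ^ η := by ring
    have hr : (g * k ^ 2 / hn1 x ^ η) * (hn1 x ^ η * hn1 x / k ^ 2) = g * hn1 x := by
      field_simp
    change (g * k ^ 2 / hn1 x ^ η) • (‖qn1 x‖ • qn1 x) = (g * k ^ 2 / hn1 x ^ η) • _
    rw [smul_neg, smul_smul, smul_smul, hl, hr, smul_add, hs]
    abel
  refine ⟨hmom, fun x => ?_⟩
  have hq : qn = -limFlux k η b hn := funext well_prepared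
  have hs := scheme_mass x
  rw [hq, ediv_neg] at hs
  linarith
end

section
/- Let d ≥ 1, let g > 0, k > 0, η ∈ ℝ, ε > 0, Δt > 0, μ ∈ ℝ, let C be a real constant, and let b : EuclideanSpace ℝ (Fin d) → ℝ be differentiable and hⁿ : EuclideanSpace ℝ (Fin d) → ℝ be positive and differentiable with hⁿ(x) + b(x) = C for all x, and let qⁿ be the zero vector field. Then hⁿ⁺¹ := hⁿ and qⁿ⁺¹ := 0 satisfy the first-order IMEX scheme equations: for all x, (hⁿ⁺¹(x) − hⁿ(x))/Δt + div qⁿ(x) + μ·div Φ(hⁿ)(x) = μ·div Φ(hⁿ⁺¹)(x), and (qⁿ⁺¹(x) − qⁿ(x))/Δt + div((qⁿ ⊗ qⁿ)/hⁿ)(x) + (1/ε²)·∇((g/2)·(hⁿ⁺¹)²)(x) = −(1/ε²)·g·hⁿ⁺¹(x)·∇b(x) − (1/ε²)·(g·k²·‖qⁿ⁺¹(x)‖/hⁿ⁺¹(x)^η) • qⁿ⁺¹(x), where div((qⁿ ⊗ qⁿ)/hⁿ) denotes the row-wise divergence of the (identically zero) matrix field x ↦ (qⁿ(x) ⊗ qⁿ(x))/hⁿ(x).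 Hence the scheme preserves the lake-at-rest equilibrium (well-balanced property). -/
open scoped BigOperators

/-- Row-wise divergence of a matrix field on `EuclideanSpace ℝ (Fin d)`. -/
noncomputable def mdivRow {d : ℕ}
    (M : EuclideanSpace ℝ (Fin d) → Matrix (Fin d) (Fin d) ℝ)
    (x : EuclideanSpace ℝ (Fin d)) : EuclideanSpace ℝ (Fin d) :=
  (WithLp.equiv 2 (Fin d → ℝ)).symm
    (fun i => ∑ j, fderiv ℝ (fun y => M y i j) x (EuclideanSpace.single j 1))

theorem ediv_zero {d : ℕ} (x : EuclideanSpace ℝ (Fin d)) : ediv (fun _ => 0) x = 0 := by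
  simp [ediv]

theorem mdivRow_zero {d : ℕ} (x : EuclideanSpace ℝ (Fin d)) :
    mdivRow (fun _ => Matrix.of fun _ _ => (0 : ℝ)) x = 0 := by
  ext i
  simp [mdivRow]

/-- For a lake at rest the hydrostatic pressure gradient balances the topography source. -/
theorem gradient_pressure_of_add_eq_const {d : ℕ} (g C : ℝ)
    {b h : EuclideanSpace ℝ (Fin d) → ℝ} (hh : Differentiable ℝ h)
    (heq : ∀ x, h x + b x = C) (x : EuclideanSpace ℝ (Fin d)) :
    gradient (fun y => (g / 2) * (h y) ^ 2) x = -((g * h x) • gradient b x) := by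
  have hb : b = fun y => C - h y := funext fun y => by linarith [heq y]
  have hp : HasFDerivAt (fun y => (g / 2) * (h y) ^ 2) ((g * h x) • fderiv ℝ h x) x := by
    refine (((hh x).hasFDerivAt.pow 2).const_mul (g / 2)).congr_fderiv ?_
    ext v
    simp
    ring
  simp only [gradient]
  rw [hp.fderiv, hb, fderiv_const_sub]
  simp

/-- Well-balanced property of the first-order IMEX scheme: the lake-at-rest equilibrium
`hⁿ + b = C`, `qⁿ = 0` is preserved, i.e. `hⁿ⁺¹ = hⁿ` and `qⁿ⁺¹ = 0` satisfy the
scheme equations. -/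
theorem first_order_imex_well_balanced (d : ℕ) (hd : 1 ≤ d)
    (g k η ε Δt μ : ℝ) (hg : 0 < g) (hk : 0 < k) (hε : 0 < ε) (hΔt : 0 < Δt)
    (C : ℝ)
    (b : EuclideanSpace ℝ (Fin d) → ℝ) (hb : Differentiable ℝ b)
    (hn : EuclideanSpace ℝ (Fin d) → ℝ)
    (hn_pos : ∀ x, 0 < hn x) (hn_diff : Differentiable ℝ hn)
    (heq : ∀ x, hn x + b x = C)
    (qn : EuclideanSpace ℝ (Fin d) → EuclideanSpace ℝ (Fin d))
    (hqn : ∀ x, qn x = 0) :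
    ∀ hn1 qn1,
      hn1 = hn → qn1 = qn →
      (∀ x, (hn1 x - hn x) / Δt + ediv qn x + μ * ediv (limFlux k η b hn) x
          = μ * ediv (limFlux k η b hn1) x) ∧
      (∀ x, (1 / Δt) • (qn1 x - qn x)
            + mdivRow (fun y => Matrix.of fun i j => qn y i * qn y j / hn y) x
            + (1 / ε ^ 2) • gradient (fun y => (g / 2) * (hn1 y) ^ 2) x
          = -((1 / ε ^ 2) • ((g * hn1 x) • gradient b x))
            - (1 / ε ^ 2) • ((g * k ^ 2 * ‖qn1 x‖ / (hn1 x) ^ η) • qn1 x)) := by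
  obtain rfl : qn = fun _ => 0 := funext hqn
  rintro _ _ rfl rfl
  refine ⟨fun x => by simp [ediv_zero], fun x => ?_⟩
  rw [gradient_pressure_of_add_eq_const g C hn_diff heq x]
  simp [mdivRow_zero]
end
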